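/- Let G be a simple graph and let S_0, S_1, …, S_m be a sequence of nonempty vertex sets of G, each of cardinality 1 or 2, such that any two-element set consists of two adjacent vertices, and such that each S_{k+1} is obtained from S_k either by adding one vertex adjacent to the vertex of S_k (an expansion, only when |S_k| = 1) or by removing one vertex of S_k (a contraction, only when |S_k| = 2). If S_0 = {u} and S_m = {v}, then m ≥ 2·dist_G(u,v), where dist_G denotes graph distance in G. -/

import Mathlib

/-- One step of a particle trajectory in a simple graph `G`: the occupied set `s`
(of size 1 or 2, a two-element set always consisting of adjacent vertices) turns into `t`
either by an expansion (adding a vertex adjacent to the single vertex of `s`)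
or by a contraction (removing one of the two vertices of `s`). -/
def TrajStep {V : Type*} [DecidableEq V] (G : SimpleGraph V) (s t : Finset V) : Prop :=
  (∃ u v : V, s = {u} ∧ G.Adj u v ∧ t = {u, v}) ∨
  (∃ u v : V, G.Adj u v ∧ s = {u, v} ∧ (t = {u} ∨ t = {v}))

/-- Along a trajectory starting contracted at `u`, every vertex occupied at time `k` is reached
from `u` by a walk of length at most `(k + |S k| - 1) / 2`. -/
theorem exists_walk_of_mem_trajectory {V : Type*} [DecidableEq V] {G : SimpleGraph V} {m : ℕ}
    {S : ℕ → Finset V} {u : V} (hstep : ∀ k < m, TrajStep G (S k) (S (k + 1)))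
    (h0 : S 0 = {u}) {k : ℕ} (hk : k ≤ m) {x : V} (hx : x ∈ S k) :
    ∃ p : G.Walk u x, 2 * p.length + 1 ≤ k + (S k).card := by
  induction k generalizing x with
  | zero =>
    obtain rfl : x = u := by simpa [h0] using hx
    exact ⟨.nil, by simp [h0]⟩
  | succ k ih =>
    replace ih := fun y => @ih (by omega) y
    rcases hstep k hk with ⟨a, b, hs, hab, ht⟩ | ⟨a, b, hab, hs, ht⟩
    · obtain ⟨p, hp⟩ := ih a (by simp [hs])
      rw [hs, Finset.card_singleton] at hp
      rw [ht, Finset.card_pair hab.ne]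
      rw [ht, Finset.mem_insert, Finset.mem_singleton] at hx
      rcases hx with rfl | rfl
      · exact ⟨p, by omega⟩
      · exact ⟨p.concat hab, by rw [SimpleGraph.Walk.length_concat]; omega⟩
    · have hxs : x ∈ S k := by
        rcases ht with ht | ht <;> rw [ht, Finset.mem_singleton] at hx <;> simp [hs, hx]
      have hcard : (S (k + 1)).card = 1 := by
        rcases ht with ht | ht <;> simp [ht]
      obtain ⟨p, hp⟩ := ih x hxs
      rw [hs, Finset.card_pair hab.ne] at hp
      exact ⟨p, by omega⟩

/-- If a particle trajectory of length `m` starts contracted at `u` and ends contracted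
at `v`, then `m ≥ 2 · dist_G(u, v)`. -/
theorem trajectory_length_lower_bound {V : Type*} [DecidableEq V] (G : SimpleGraph V) (m : ℕ)
    (S : ℕ → Finset V) (u v : V)
    (hstep : ∀ k < m, TrajStep G (S k) (S (k + 1)))
    (h0 : S 0 = {u}) (hm : S m = {v}) :
    2 * G.dist u v ≤ m := by
  obtain ⟨p, hp⟩ := exists_walk_of_mem_trajectory hstep h0 le_rfl (x := v) (by simp [hm])
  rw [hm, Finset.card_singleton] at hp
  have := SimpleGraph.dist_le p
  omega
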